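/- arXiv:1309.5462 — 3 statements merged into one kernel-verified Lean document; each statement's English description precedes it below -/
import Mathlib

section
/- Let G be an MPG with limited-observation and let ρ be a bad abstract cycle. Then there exist k ≥ 1 and a concrete path π ∈ γ(ρ^k) that starts and ends at the same state (a concrete cycle) with weight w(π) < 0. -/
open Classical

/-- A mean-payoff game (MPG) with partial-observation. -/
structure MPG where
  Q : Type
  A : Type
  fintypeQ : Fintype Q
  decEqQ : DecidableEq Q
  fintypeA : Fintype A
  nonemptyA : Nonempty A
  qI : Q
  delta : Q → A → Q → Prop
  total : ∀ q a, ∃ q', delta q a q'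
  w : Q → A → Q → ℤ
  Obs : Set (Set Q)
  partition : Setoid.IsPartition Obs

namespace MPG

variable (G : MPG)

/-- `post_σ(o)`. -/
def post (o : Set G.Q) (a : G.A) : Set G.Q :=
  {q' | ∃ q ∈ o, G.delta q a q'}

/-- Limited-observation condition. -/
def LimitedObs : Prop :=
  ({G.qI} : Set G.Q) ∈ G.Obs ∧
    ∀ o ∈ G.Obs, ∀ a : G.A, ∃ S ⊆ G.Obs, G.post o a = ⋃₀ S

/-- Infinite concrete paths, as sequences of state-action pairs. -/
def IsConcretePath (π : ℕ → G.Q × G.A) : Prop :=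
  ∀ i, G.delta (π i).1 (π i).2 (π (i + 1)).1

/-- weight of the first `n` transitions of a concrete path -/
def sumW (π : ℕ → G.Q × G.A) (n : ℕ) : ℤ :=
  ∑ i ∈ Finset.range n, G.w (π i).1 (π i).2 (π (i + 1)).1

/-- Mean payoff (`liminf`). -/
noncomputable def MP (π : ℕ → G.Q × G.A) : ℝ :=
  Filter.liminf (fun n => (G.sumW π n : ℝ) / (n : ℝ)) Filter.atTop

/-- Infinite abstract paths, as sequences of observation-action pairs. -/
def IsAbstractPath (ψ : ℕ → Set G.Q × G.A) : Prop :=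
  (∀ i, (ψ i).1 ∈ G.Obs) ∧
    ∀ i, ∃ q ∈ (ψ i).1, ∃ q' ∈ (ψ (i + 1)).1, G.delta q (ψ i).2 q'

/-- `γ(ψ)`: concrete paths compatible with an abstract path. -/
def gamma (ψ : ℕ → Set G.Q × G.A) : Set (ℕ → G.Q × G.A) :=
  {π | G.IsConcretePath π ∧ ∀ i, (π i).1 ∈ (ψ i).1 ∧ (π i).2 = (ψ i).2}

/-- A play: an infinite abstract path starting at the observation containing `qI`. -/
def IsPlay (ψ : ℕ → Set G.Q × G.A) : Prop :=
  G.IsAbstractPath ψ ∧ G.qI ∈ (ψ 0).1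

def WinningForEve (ψ : ℕ → Set G.Q × G.A) : Prop :=
  ∀ π ∈ G.gamma ψ, 0 ≤ G.MP π

def WinningForAdam (ψ : ℕ → Set G.Q × G.A) : Prop :=
  ∃ π ∈ G.gamma ψ, G.MP π < 0

/-- the prefix `o₀σ₀…o_{i-1}σ_{i-1}` of a play -/
def hist (ψ : ℕ → Set G.Q × G.A) (i : ℕ) : List (Set G.Q × G.A) :=
  (List.range i).map ψ

/-- An observation-based strategy for Eve: from a play prefix
`o₀σ₀…o_{n-1}σ_{n-1}` together with the current observation `o_n`, choose an action. -/
def EveStrategy : Type :=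
  List (Set G.Q × G.A) → Set G.Q → G.A

def ConsistentE (st : G.EveStrategy) (ψ : ℕ → Set G.Q × G.A) : Prop :=
  ∀ i, (ψ i).2 = st (G.hist ψ i) (ψ i).1

def EveWinningStrategy (st : G.EveStrategy) : Prop :=
  ∀ ψ, G.IsPlay ψ → G.ConsistentE st ψ → G.WinningForEve ψ

/-- Eve's strategy `st` has memory `m`. -/
def HasMemory (st : G.EveStrategy) (m : ℕ) : Prop :=
  ∃ (M : Type) (inst : Fintype M) (m0 : M)
    (αu : M → Set G.Q → M) (αo : M → Set G.Q → G.A),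
    @Fintype.card M inst = m ∧
      ∀ ψ : ℕ → Set G.Q × G.A, G.IsPlay ψ → ∀ i,
        st (G.hist ψ i) (ψ i).1 =
          αo ((G.hist ψ i).foldl (fun x p => αu x p.1) m0) (ψ i).1

def FiniteMemory (st : G.EveStrategy) : Prop :=
  ∃ m, G.HasMemory st m

/-- An observation-based strategy for Adam. -/
def AdamStrategy : Type :=
  List (Set G.Q × G.A) → Set G.Q → G.A → Set G.Q

def AdamStrategyValid (st : G.AdamStrategy) : Prop :=
  ∀ ψ : ℕ → Set G.Q × G.A, G.IsPlay ψ → ∀ i, ∀ a : G.A,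
    st (G.hist ψ i) (ψ i).1 a ∈ G.Obs ∧
      (st (G.hist ψ i) (ψ i).1 a ∩ G.post (ψ i).1 a).Nonempty

def ConsistentA (st : G.AdamStrategy) (ψ : ℕ → Set G.Q × G.A) : Prop :=
  ∀ i, (ψ (i + 1)).1 = st (G.hist ψ i) (ψ i).1 (ψ i).2

def AdamWinningStrategy (st : G.AdamStrategy) : Prop :=
  G.AdamStrategyValid st ∧
    ∀ ψ, G.IsPlay ψ → G.ConsistentA st ψ → G.WinningForAdam ψ

/-- Adam's strategy `st` has memory `m`. -/
def AdamHasMemory (st : G.AdamStrategy) (m : ℕ) : Prop :=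
  ∃ (M : Type) (inst : Fintype M) (m0 : M)
    (αu : M → Set G.Q → G.A → M) (αo : M → Set G.Q → G.A → Set G.Q),
    @Fintype.card M inst = m ∧
      ∀ ψ : ℕ → Set G.Q × G.A, G.IsPlay ψ → ∀ i, ∀ a : G.A,
        st (G.hist ψ i) (ψ i).1 a =
          αo ((G.hist ψ i).foldl (fun x p => αu x p.1 p.2) m0) (ψ i).1 a

/-- The set `F` of functions `Q → ℤ ∪ {+∞, ⊥}`; `none` plays the role of `⊥`
and `some ⊤` the role of `+∞`. -/
abbrev FF : Type := G.Q → Option (WithTop ℤ)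

def Fsupp (f : G.FF) : Set G.Q := {q | f q ≠ none}

/-- The candidate values `f(q') + w(q',σ,q)` used in the definition of a σ-successor
(with the convention `+∞ + k = +∞`). -/
def transVals (f : G.FF) (a : G.A) (q : G.Q) : Set (WithTop ℤ) :=
  {x | ∃ q' v, f q' = some v ∧ G.delta q' a q ∧ x = v + (G.w q' a q : WithTop ℤ)}

def IsMinOf (m : WithTop ℤ) (s : Set (WithTop ℤ)) : Prop :=
  m ∈ s ∧ ∀ x ∈ s, m ≤ x

/-- `f'` is a σ-successor of `f`. -/
def IsSucc (f : G.FF) (a : G.A) (f' : G.FF) : Prop :=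
  G.Fsupp f' ∈ G.Obs ∧ G.Fsupp f' ⊆ G.post (G.Fsupp f) a ∧
    ∀ q ∈ G.Fsupp f', f' q = some ⊤ ∨
      ∃ m, f' q = some m ∧ IsMinOf m (G.transVals f a q)

/-- `f'` is a proper σ-successor of `f`. -/
def IsProperSucc (f : G.FF) (a : G.A) (f' : G.FF) : Prop :=
  G.IsSucc f a f' ∧
    ∀ q ∈ G.Fsupp f', ∃ m, f' q = some m ∧ IsMinOf m (G.transVals f a q)

/-- the order `f ⪯ₖ f'`. -/
def prec (k : ℕ) (f f' : G.FF) : Prop :=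
  G.Fsupp f = G.Fsupp f' ∧
    ∀ q ∈ G.Fsupp f, ∃ v v', f q = some v ∧ f' q = some v' ∧
      v + ((k : ℤ) : WithTop ℤ) ≤ v'

/-- positions of the reachability game associated with `G`: the sequence
`f₀σ₀f₁…σ_{n-1}fₙ` is represented by the list `[(f₀,σ₀),…,(f_{n-1},σ_{n-1})]`
together with the final function `fₙ`. -/
abbrev Pos : Type := List (G.FF × G.A) × G.FF

def fI : G.FF := fun q =>
  letI := G.decEqQ
  if q = G.qI then some ((0 : ℤ) : WithTop ℤ) else none

def initPos : G.Pos := ([], G.fI)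

/-- the `i`-th function of a position (the final one for `i ≥ length`). -/
def posFun (p : G.Pos) (i : ℕ) : G.FF :=
  if h : i < p.1.length then (p.1.get ⟨i, h⟩).1 else p.2

/-- membership in `Π_G`. -/
def ValidPos (p : G.Pos) : Prop :=
  G.posFun p 0 = G.fI ∧
    (∀ i (hi : i < p.1.length),
      G.IsSucc (G.posFun p i) (p.1.get ⟨i, hi⟩).2 (G.posFun p (i + 1))) ∧
    ∀ i j, i < j → j < p.1.length →
      ¬ G.prec 0 (G.posFun p i) (G.posFun p j) ∧
        ¬ G.prec 1 (G.posFun p j) (G.posFun p i)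

/-- membership in `T_E`. -/
def inTE (p : G.Pos) : Prop :=
  ∃ i < p.1.length, G.prec 0 (G.posFun p i) p.2

/-- membership in `T_A`. -/
def inTA (p : G.Pos) : Prop :=
  ∃ i < p.1.length, G.prec 1 p.2 (G.posFun p i) ∧
    ∃ q ∈ G.Fsupp (G.posFun p i), G.posFun p i q ≠ some ⊤

def TerminalPos (p : G.Pos) : Prop := G.inTE p ∨ G.inTA p

def extend (p : G.Pos) (a : G.A) (f : G.FF) : G.Pos :=
  (p.1 ++ [(p.2, a)], f)

/-- One step of the reachability game (with validity predicate `V`), consistent with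
Eve's strategy `sE`: at a terminal position the play stops (stutters); otherwise Eve
plays `sE p` and Adam picks any successor giving a valid position (if there is none,
the play stutters). -/
def EveNext (V : G.Pos → Prop) (sE : G.Pos → G.A) (p p' : G.Pos) : Prop :=
  (G.TerminalPos p → p' = p) ∧
    (¬ G.TerminalPos p →
      (∃ f, p' = G.extend p (sE p) f ∧ V p') ∨
        ((¬ ∃ f, V (G.extend p (sE p) f)) ∧ p' = p))

/-- Eve wins the reachability game with positions `V` using strategy `sE`. -/
def EveWinningR (V : G.Pos → Prop) (sE : G.Pos → G.A) : Prop :=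
  ∀ ps : ℕ → G.Pos, ps 0 = G.initPos →
    (∀ k, G.EveNext V sE (ps k) (ps (k + 1))) → ∃ k, G.inTE (ps k)

/-- One step of the reachability game, consistent with Adam's strategy `sA`. -/
def AdamNext (V : G.Pos → Prop) (sA : G.Pos → G.A → G.FF) (p p' : G.Pos) : Prop :=
  (G.TerminalPos p → p' = p) ∧
    (¬ G.TerminalPos p → ∃ a : G.A,
      (V (G.extend p a (sA p a)) ∧ p' = G.extend p a (sA p a)) ∨
        ((¬ ∃ f, V (G.extend p a f)) ∧ p' = p))

/-- Adam wins the reachability game with positions `V` using strategy `sA`. -/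
def AdamWinningR (V : G.Pos → Prop) (sA : G.Pos → G.A → G.FF) : Prop :=
  ∀ ps : ℕ → G.Pos, ps 0 = G.initPos →
    (∀ k, G.AdamNext V sA (ps k) (ps (k + 1))) → ∃ k, G.inTA (ps k)

/-- `G` is forcibly terminating: some player wins `Γ_G`. -/
def ForciblyTerminating : Prop :=
  (∃ sE, G.EveWinningR G.ValidPos sE) ∨ (∃ sA, G.AdamWinningR G.ValidPos sA)

/-- membership in `Π'_G`: positions of `Γ'_G` (pairwise distinct supports). -/
def ValidPos' (p : G.Pos) : Prop :=
  G.ValidPos p ∧ ∀ i j, i < j → j < p.1.length →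
    G.Fsupp (G.posFun p i) ≠ G.Fsupp (G.posFun p j)

/-- `G` is forcibly FAC: some player wins `Γ'_G`. -/
def ForciblyFAC : Prop :=
  (∃ sE, G.EveWinningR G.ValidPos' sE) ∨ (∃ sA, G.AdamWinningR G.ValidPos' sA)

/-- `G` is FAC: every leaf of `Γ'_G` is terminal. -/
def FAC : Prop :=
  ∀ p, G.ValidPos' p → (¬ ∃ a f, G.ValidPos' (G.extend p a f)) →
    G.inTE p ∨ G.inTA p

end MPG

namespace MPG

/-- A (finite) abstract cycle `o₀σ₀…oₙ` with `oₙ = o₀`. -/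
structure AbsCycle (G : MPG) where
  n : ℕ
  npos : 0 < n
  obs : ℕ → Set G.Q
  act : ℕ → G.A
  mem : ∀ i ≤ n, obs i ∈ G.Obs
  path : ∀ i < n, ∃ q ∈ obs i, ∃ q' ∈ obs (i + 1), G.delta q (act i) q'
  closed : obs n = obs 0

variable (G : MPG)

/-- A good abstract cycle. -/
def Good (c : AbsCycle G) : Prop :=
  ∃ fs : ℕ → G.FF,
    (∀ i ≤ c.n, G.Fsupp (fs i) = c.obs i) ∧
    (∀ i < c.n, G.IsSucc (fs i) (c.act i) (fs (i + 1))) ∧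
    (∀ i ≤ c.n, ∀ q ∈ G.Fsupp (fs i), fs i q ≠ some ⊤) ∧
    G.prec 0 (fs 0) (fs c.n)

/-- A bad abstract cycle. -/
def Bad (c : AbsCycle G) : Prop :=
  ∃ fs : ℕ → G.FF,
    (∀ i ≤ c.n, G.Fsupp (fs i) = c.obs i) ∧
    (∀ i < c.n, G.IsSucc (fs i) (c.act i) (fs (i + 1))) ∧
    (∃ q ∈ G.Fsupp (fs 0), fs 0 q ≠ some ⊤) ∧
    G.prec 1 (fs c.n) (fs 0)

end MPG

namespace MPG

variable {G : MPG}

/-- There is a concrete path of length `L` from `q` to `q'` that follows the periodic repetition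
of the abstract cycle `c` and has weight at most `z`. -/
def AbsCycle.Walk (c : AbsCycle G) (L : ℕ) (q q' : G.Q) (z : ℤ) : Prop :=
  ∃ π : ℕ → G.Q,
    (∀ j < L, G.delta (π j) (c.act (j % c.n)) (π (j + 1))) ∧
    (∀ j ≤ L, π j ∈ c.obs (j % c.n)) ∧ π 0 = q ∧ π L = q' ∧
    ∑ j ∈ Finset.range L, G.w (π j) (c.act (j % c.n)) (π (j + 1)) ≤ z

namespace AbsCycle

variable (c : AbsCycle G)

theorem Walk.mono {c : AbsCycle G} {L : ℕ} {q q' : G.Q} {z z' : ℤ} (h : c.Walk L q q' z)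
    (hz : z ≤ z') : c.Walk L q q' z' := by
  obtain ⟨π, hδ, hm, h0, hL, hw⟩ := h
  exact ⟨π, hδ, hm, h0, hL, hw.trans hz⟩

theorem walk_zero {q : G.Q} (hq : q ∈ c.obs 0) : c.Walk 0 q q 0 :=
  ⟨fun _ => q, by simp, by simpa using hq, rfl, rfl, by simp⟩

theorem Walk.step {c : AbsCycle G} {L : ℕ} {q q' q'' : G.Q} {z : ℤ} (h : c.Walk L q q' z)
    (hδ : G.delta q' (c.act (L % c.n)) q'') (hm : q'' ∈ c.obs ((L + 1) % c.n)) :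
    c.Walk (L + 1) q q'' (z + G.w q' (c.act (L % c.n)) q'') := by
  obtain ⟨π, hπδ, hπm, h0, hL, hw⟩ := h
  have hπ' : ∀ j ≤ L, Function.update π (L + 1) q'' j = π j := fun j hj =>
    Function.update_of_ne (by omega) _ _
  refine ⟨Function.update π (L + 1) q'', fun j hj => ?_, fun j hj => ?_, ?_, by simp, ?_⟩
  · rcases Nat.lt_succ_iff_lt_or_eq.1 hj with hj | rfl
    · rw [hπ' j hj.le, hπ' (j + 1) hj]
      exact hπδ j hj
    · rw [hπ' j le_rfl, Function.update_self, hL]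
      exact hδ
  · rcases Nat.le_succ_iff.1 hj with hj | rfl
    · rw [hπ' j hj]
      exact hπm j hj
    · simpa using hm
  · rw [hπ' 0 (Nat.zero_le _), h0]
  · rw [Finset.sum_range_succ, hπ' L le_rfl, Function.update_self, hL]
    refine add_le_add_left (le_trans (le_of_eq (Finset.sum_congr rfl fun j hj => ?_)) hw) _
    have hj := Finset.mem_range.1 hj
    rw [hπ' j hj.le, hπ' (j + 1) hj]

theorem obs_mod {m : ℕ} (k : ℕ) (hm : m ≤ c.n) : c.obs ((k * c.n + m) % c.n) = c.obs m := by
  rw [Nat.mul_add_mod_self_right]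
  rcases hm.lt_or_eq with hm | rfl
  · rw [Nat.mod_eq_of_lt hm]
  · rw [Nat.mod_self, c.closed]

end AbsCycle

theorem IsSucc.exists_pred {f f' : G.FF} {a : G.A} (h : G.IsSucc f a f') {q : G.Q} {v : ℤ}
    (hq : f' q = some (v : WithTop ℤ)) :
    ∃ q' v', f q' = some ((v' : ℤ) : WithTop ℤ) ∧ G.delta q' a q ∧ v = v' + G.w q' a q := by
  have hs : q ∈ G.Fsupp f' := by simp [Fsupp, hq]
  rcases h.2.2 q hs with ht | ⟨m, hm, ⟨⟨q', x, hx, hδ, hmx⟩, -⟩⟩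
  · rw [hq] at ht
    simp at ht
  · obtain rfl : (v : WithTop ℤ) = m := Option.some.inj (hq.symm.trans hm)
    cases x with
    | top => simp at hmx
    | coe x => exact ⟨q', x, hx, hδ, by exact_mod_cast hmx⟩

theorem AbsCycle.exists_walk_extension (c : AbsCycle G) {fs : ℕ → G.FF}
    (hsupp : ∀ i ≤ c.n, G.Fsupp (fs i) = c.obs i)
    (hsucc : ∀ i < c.n, G.IsSucc (fs i) (c.act i) (fs (i + 1))) :
    ∀ m ≤ c.n, ∀ (q : G.Q) (v : ℤ), fs m q = some (v : WithTop ℤ) →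
      ∃ (q₀ : G.Q) (v₀ : ℤ), fs 0 q₀ = some (v₀ : WithTop ℤ) ∧
        ∀ k r z, c.Walk (k * c.n) r q₀ z → c.Walk (k * c.n + m) r q (z + v - v₀) := by
  intro m
  induction m with
  | zero => exact fun _ q v hv => ⟨q, v, hv, fun k r z h => by simpa using h⟩
  | succ m ih =>
    intro hm q v hv
    obtain ⟨q', v', hv', hδ, rfl⟩ := (hsucc m hm).exists_pred hv
    obtain ⟨q₀, v₀, hv₀, h⟩ := ih (Nat.le_of_succ_le hm) q' v' hv'
    refine ⟨q₀, v₀, hv₀, fun k r z hz => ?_⟩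
    have ha : (k * c.n + m) % c.n = m := by
      rw [Nat.mul_add_mod_self_right, Nat.mod_eq_of_lt hm]
    have hq : q ∈ c.obs ((k * c.n + m + 1) % c.n) := by
      rw [add_assoc, c.obs_mod k hm, ← hsupp _ hm]
      simp [Fsupp, hv]
    have hstep := (h k r z hz).step (by rwa [ha]) hq
    rw [ha] at hstep
    exact hstep.mono (by linarith)

end MPG

/-- for a bad abstract cycle `ρ` there are `k ≥ 1` and a concrete cycle
in `γ(ρᵏ)` of strictly negative weight. -/
theorem bad_cycle_concrete_neg (G : MPG) (hG : G.LimitedObs)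
    (c : MPG.AbsCycle G) (hbad : G.Bad c) :
    ∃ k ≥ 1, ∃ π : ℕ → G.Q,
      (∀ j < k * c.n, G.delta (π j) (c.act (j % c.n)) (π (j + 1))) ∧
      (∀ j ≤ k * c.n, π j ∈ c.obs (j % c.n)) ∧
      π (k * c.n) = π 0 ∧
      (∑ j ∈ Finset.range (k * c.n), G.w (π j) (c.act (j % c.n)) (π (j + 1))) < 0 := by
  obtain ⟨fs, hsupp, hsucc, ⟨q, hq, hqt⟩, hsub, hdec⟩ := hbad
  have := G.fintypeQ
  let S := {q : G.Q // ∃ v : ℤ, fs 0 q = some (v : WithTop ℤ)}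
  have hne : Nonempty S := by
    obtain ⟨x, hx⟩ := Option.ne_none_iff_exists'.1 hq
    cases x with
    | top => exact absurd hx hqt
    | coe v => exact ⟨q, v, hx⟩
  choose F hF using fun s : S => s.2
  have hpred : ∀ s : S, ∃ s' : S, ∀ k r z, c.Walk (k * c.n) r s' z →
      c.Walk ((k + 1) * c.n) r s (z + F s - F s' - 1) := by
    intro s
    have hs : s.1 ∈ G.Fsupp (fs c.n) := by
      rw [hsub]
      simp [MPG.Fsupp, hF s]
    obtain ⟨v, v', hv, hv', hle⟩ := hdec s hs
    obtain rfl : (F s : WithTop ℤ) = v' := Option.some.inj ((hF s).symm.trans hv')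
    cases v with
    | top => simp at hle
    | coe v =>
      have hle : v + 1 ≤ F s := by exact_mod_cast hle
      obtain ⟨q₀, v₀, hv₀, h⟩ := c.exists_walk_extension hsupp hsucc c.n le_rfl s v hv
      refine ⟨⟨q₀, v₀, hv₀⟩, fun k r z hz => ?_⟩
      have hF₀ : F ⟨q₀, v₀, hv₀⟩ = v₀ := by
        have := (hF ⟨q₀, v₀, hv₀⟩).symm.trans hv₀
        exact_mod_cast Option.some.inj this
      rw [add_one_mul, hF₀]
      exact (h k r z hz).mono (by linarith)
  choose g hg using hpred
  have hiter : ∀ k (s : S), c.Walk (k * c.n) (g^[k] s) s (F s - F (g^[k] s) - k) := by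
    intro k
    induction k with
    | zero =>
      intro s
      have hs : s.1 ∈ c.obs 0 := by
        rw [← hsupp 0 (Nat.zero_le _)]
        simp [MPG.Fsupp, hF s]
      simpa using c.walk_zero hs
    | succ k ih =>
      intro s
      rw [Function.iterate_succ_apply]
      refine (hg s k _ _ (ih (g s))).mono ?_
      push_cast
      linarith
  obtain ⟨s₀⟩ := hne
  obtain ⟨i, j, hij, heq⟩ : ∃ i j, i < j ∧ g^[i] s₀ = g^[j] s₀ := by
    obtain ⟨i, j, hne, heq⟩ := Finite.exists_ne_map_eq_of_infinite fun i : ℕ => g^[i] s₀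
    rcases hne.lt_or_gt with h | h
    · exact ⟨i, j, h, heq⟩
    · exact ⟨j, i, h, heq.symm⟩
  have hper : g^[j - i] (g^[i] s₀) = g^[i] s₀ := by
    rw [← Function.iterate_add_apply, Nat.sub_add_cancel hij.le, heq]
  obtain ⟨π, hδ, hm, h0, hL, hw⟩ := hiter (j - i) (g^[i] s₀)
  rw [hper] at h0 hw
  refine ⟨j - i, by omega, π, hδ, hm, hL.trans h0.symm, ?_⟩
  have : (0 : ℤ) < ((j - i : ℕ) : ℤ) := by omega
  linarith
end

section
/- Let G be an MPG with limited-observation and Γ_G its associated reachability game. If Eve has a winning strategy in Γ_G, then Eve has a finite-memory winning observation-based strategy in G (an observation-based strategy with memory m for some m ∈ ℕ such that every consistent play ψ satisfies MP(π) ≥ 0 for all π ∈ γ(ψ)). -/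
open Classical

namespace MPG

/-- A concrete path whose partial sums are bounded below has nonnegative mean payoff. -/
theorem MP_nonneg_of_le_sumW (G : MPG) (π : ℕ → G.Q × G.A) (B : ℤ)
    (hB : ∀ n, B ≤ G.sumW π n) : 0 ≤ G.MP π := by
  have := G.fintypeQ
  have := G.fintypeA
  obtain ⟨C, hC⟩ : ∃ C : ℤ, ∀ x : G.Q × G.A × G.Q, G.w x.1 x.2.1 x.2.2 ≤ C := by
    obtain ⟨C, hC⟩ :=
      (Set.finite_range fun x : G.Q × G.A × G.Q => G.w x.1 x.2.1 x.2.2).bddAbove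
    exact ⟨C, fun x => hC ⟨x, rfl⟩⟩
  have hsum (n : ℕ) : G.sumW π n ≤ n * C := by
    have := Finset.sum_le_card_nsmul (Finset.range n)
      (fun i => G.w (π i).1 (π i).2 (π (i + 1)).1) C
      (fun i _ => hC ((π i).1, (π i).2, (π (i + 1)).1))
    simpa [sumW] using this
  have hup (n : ℕ) : (G.sumW π n : ℝ) / n ≤ max (C : ℝ) 0 := by
    rcases Nat.eq_zero_or_pos n with rfl | hn
    · simp
    · refine le_trans ?_ (le_max_left _ _)
      rw [div_le_iff₀ (by exact_mod_cast hn), mul_comm]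
      exact_mod_cast hsum n
  have hlow (n : ℕ) : (B : ℝ) / n ≤ (G.sumW π n : ℝ) / n := by
    gcongr
    exact_mod_cast hB n
  have hlim : Filter.Tendsto (fun n : ℕ => (B : ℝ) / n) Filter.atTop (nhds 0) :=
    tendsto_const_div_atTop_nhds_zero_nat _
  rw [MP, ← hlim.liminf_eq]
  refine Filter.liminf_le_liminf (Filter.Eventually.of_forall hlow)
    hlim.isBoundedUnder_ge ?_
  exact Filter.IsBoundedUnder.isCoboundedUnder_ge
    ⟨max (C : ℝ) 0, Filter.eventually_map.2 (Filter.Eventually.of_forall hup)⟩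

theorem isMinOf_unique {m m' : WithTop ℤ} {s : Set (WithTop ℤ)} (h : IsMinOf m s)
    (h' : IsMinOf m' s) : m = m' :=
  le_antisymm (h.2 _ h'.1) (h'.2 _ h.1)

variable {G : MPG}

theorem isProperSucc_ext {f f₁ f₂ : G.FF} {a : G.A} (h₁ : G.IsProperSucc f a f₁)
    (h₂ : G.IsProperSucc f a f₂) (h : G.Fsupp f₁ = G.Fsupp f₂) : f₁ = f₂ := by
  funext q
  by_cases hq : q ∈ G.Fsupp f₁
  · obtain ⟨m, hm, hmin⟩ := h₁.2 q hq
    obtain ⟨m', hm', hmin'⟩ := h₂.2 q (h ▸ hq)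
    rw [hm, hm', isMinOf_unique hmin hmin']
  · have hq' : q ∉ G.Fsupp f₂ := h ▸ hq
    simp only [Fsupp, Set.mem_ofPred_eq, not_not] at hq hq'
    rw [hq, hq']

theorem exists_isMinOf_transVals (f : G.FF) (a : G.A) {q : G.Q}
    (hq : q ∈ G.post (G.Fsupp f) a) : ∃ m, IsMinOf m (G.transVals f a q) := by
  have := G.fintypeQ
  have hfin : (G.transVals f a q).Finite := by
    refine (Set.finite_range fun q' : G.Q =>
      (f q').getD 0 + (G.w q' a q : WithTop ℤ)).subset ?_
    rintro x ⟨q', v, hv, -, rfl⟩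
    exact ⟨q', by simp [hv]⟩
  have hne : (G.transVals f a q).Nonempty := by
    obtain ⟨q', hq', hd⟩ := hq
    obtain ⟨v, hv⟩ := Option.ne_none_iff_exists'.1 hq'
    exact ⟨_, q', v, hv, hd, rfl⟩
  obtain ⟨m, hm, hmin⟩ := Set.exists_min_image _ id hfin hne
  exact ⟨m, hm, hmin⟩

theorem exists_isProperSucc (f : G.FF) (a : G.A) {o : Set G.Q} (ho : o ∈ G.Obs)
    (hpost : o ⊆ G.post (G.Fsupp f) a) :
    ∃ f', G.IsProperSucc f a f' ∧ G.Fsupp f' = o := by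
  choose m hm using fun q : o => exists_isMinOf_transVals f a (hpost q.2)
  set f' : G.FF := fun q => if hq : q ∈ o then some (m ⟨q, hq⟩) else none with hf'
  have hsupp : G.Fsupp f' = o := by
    ext q
    by_cases hq : q ∈ o <;> simp [Fsupp, hf', hq]
  have hval : ∀ q ∈ G.Fsupp f', ∃ v, f' q = some v ∧ IsMinOf v (G.transVals f a q) := by
    intro q hq
    rw [hsupp] at hq
    exact ⟨m ⟨q, hq⟩, by simp [hf', hq], hm ⟨q, hq⟩⟩
  exact ⟨f', ⟨⟨hsupp ▸ ho, hsupp ▸ hpost, fun q hq => Or.inr (hval q hq)⟩, hval⟩, hsupp⟩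

theorem fsupp_fI : G.Fsupp G.fI = {G.qI} := by
  ext q
  by_cases hq : q = G.qI <;> simp [Fsupp, fI, hq]

theorem not_terminalPos_initPos : ¬ G.TerminalPos G.initPos := by
  simp [TerminalPos, inTE, inTA, initPos]

theorem posFun_extend_of_lt {p : G.Pos} (a : G.A) (f : G.FF) {i : ℕ}
    (hi : i < p.1.length) : G.posFun (G.extend p a f) i = G.posFun p i := by
  have : i < p.1.length + 1 := by omega
  simp [posFun, extend, hi, this, List.getElem_append_left]

theorem posFun_length (p : G.Pos) : G.posFun p p.1.length = p.2 := by
  simp [posFun]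

theorem posFun_extend_of_le {p : G.Pos} (a : G.A) (f : G.FF) {i : ℕ}
    (hi : i ≤ p.1.length) : G.posFun (G.extend p a f) i = G.posFun p i := by
  rcases hi.lt_or_eq with hi | rfl
  · exact posFun_extend_of_lt a f hi
  · simp [posFun, extend]

theorem posFun_extend_succ (p : G.Pos) (a : G.A) (f : G.FF) :
    G.posFun (G.extend p a f) (p.1.length + 1) = f := by
  simp [posFun, extend]

theorem length_extend (p : G.Pos) (a : G.A) (f : G.FF) :
    (G.extend p a f).1.length = p.1.length + 1 := by
  simp [extend]

theorem validPos_extend {p : G.Pos} {a : G.A} {f : G.FF} (hp : G.ValidPos p)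
    (hf : G.IsSucc p.2 a f) (hE : ¬ G.inTE p)
    (hA : ∀ i < p.1.length, ¬ G.prec 1 p.2 (G.posFun p i)) :
    G.ValidPos (G.extend p a f) := by
  refine ⟨?_, ?_, ?_⟩
  · rw [posFun_extend_of_le _ _ (Nat.zero_le _), hp.1]
  · intro i hi
    rw [length_extend] at hi
    rcases (Nat.lt_succ_iff.1 hi).lt_or_eq with hi' | rfl
    · rw [posFun_extend_of_le _ _ hi'.le, posFun_extend_of_le _ _ hi']
      simpa [extend, List.getElem_append_left, hi'] using hp.2.1 i hi'
    · rw [posFun_extend_of_le _ _ le_rfl, posFun_extend_succ, posFun_length]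
      simpa [extend] using hf
  · intro i j hij hj
    rw [length_extend] at hj
    rw [posFun_extend_of_le _ _ (by omega), posFun_extend_of_le _ _ (by omega)]
    rcases (Nat.lt_succ_iff.1 hj).lt_or_eq with hj' | rfl
    · exact hp.2.2 i j hij hj'
    · rw [posFun_length]
      exact ⟨fun h => hE ⟨i, hij, h⟩, hA i hij⟩

/-- One step of `Γ_G` consistent with `sE` in which Adam picks a proper successor. -/
def ProperNext (sE : G.Pos → G.A) (p p' : G.Pos) : Prop :=
  ¬ G.TerminalPos p ∧ ∃ f, G.IsProperSucc p.2 (sE p) f ∧ p' = G.extend p (sE p) f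

/-- Positions reachable when Eve plays `sE` and Adam picks proper successors only. -/
def Reach (sE : G.Pos → G.A) : G.Pos → Prop :=
  Relation.ReflTransGen (ProperNext sE) G.initPos

theorem finite_properNext (sE : G.Pos → G.A) (p : G.Pos) :
    {p' | ProperNext sE p p'}.Finite := by
  have := G.fintypeQ
  refine Set.Finite.of_finite_image (f := fun p' => G.Fsupp p'.2) (Set.toFinite _) ?_
  rintro _ ⟨-, f₁, h₁, rfl⟩ _ ⟨-, f₂, h₂, rfl⟩ h
  rw [isProperSucc_ext h₁ h₂ h]

theorem Reach.fsupp_mem_obs {sE : G.Pos → G.A} (hG : G.LimitedObs) {p : G.Pos}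
    (hp : Reach sE p) : G.Fsupp p.2 ∈ G.Obs := by
  rcases Relation.ReflTransGen.cases_tail hp with rfl | ⟨p', -, -, f, hf, rfl⟩
  · exact fsupp_fI.symm ▸ hG.1
  · exact hf.1.1

theorem Reach.ne_top {sE : G.Pos → G.A} {p : G.Pos} (hp : Reach sE p) :
    ∀ q, p.2 q ≠ some ⊤ := by
  induction hp with
  | refl =>
    intro q
    by_cases hq : q = G.qI <;> simp [initPos, fI, hq]
  | tail _ hnext ih =>
    obtain ⟨-, f, hf, rfl⟩ := hnext
    intro q hq
    change f q = some ⊤ at hq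
    obtain ⟨m, hm, ⟨q', v, hv, -, rfl⟩, -⟩ := hf.2 q (by simp [Fsupp, hq])
    rw [hq, Option.some.injEq, eq_comm, WithTop.add_eq_top] at hm
    rcases hm with rfl | hm
    · exact ih q' hv
    · exact WithTop.coe_ne_top hm

theorem Reach.exists_prefix {sE : G.Pos → G.A} {p : G.Pos} (hp : Reach sE p) :
    ∀ i < p.1.length, ∃ p', Reach sE p' ∧ ¬ G.TerminalPos p' ∧ p'.2 = G.posFun p i := by
  induction hp with
  | refl => simp [initPos]
  | @tail p _ hp hnext ih =>
    obtain ⟨hterm, f, hf, rfl⟩ := hnext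
    intro i hi
    rw [length_extend] at hi
    rw [posFun_extend_of_le _ _ (by omega)]
    rcases (Nat.lt_succ_iff.1 hi).lt_or_eq with hi' | rfl
    · exact ih i hi'
    · exact ⟨p, hp, hterm, (posFun_length p).symm⟩

theorem Reach.validPos {sE : G.Pos → G.A} (hG : G.LimitedObs) {p : G.Pos}
    (hp : Reach sE p) : G.ValidPos p := by
  induction hp with
  | refl => simp [ValidPos, posFun, initPos]
  | @tail p _ hp hnext ih =>
    obtain ⟨hterm, f, hf, rfl⟩ := hnext
    refine validPos_extend ih hf.1 (fun h => hterm (Or.inl h)) fun i hi hprec => ?_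
    obtain ⟨p', hp', -, hp'i⟩ := Reach.exists_prefix hp i hi
    have hobs := Reach.fsupp_mem_obs hG hp'
    obtain ⟨q, hq⟩ := Setoid.nonempty_of_mem_partition G.partition hobs
    exact hterm (Or.inr ⟨i, hi, hprec, q, hp'i ▸ hq, hp'i ▸ hp'.ne_top q⟩)

theorem ProperNext.eveNext {sE : G.Pos → G.A} (hG : G.LimitedObs) {p p' : G.Pos}
    (hp : Reach sE p) (h : ProperNext sE p p') : G.EveNext G.ValidPos sE p p' := by
  refine ⟨fun ht => absurd ht h.1, fun _ => Or.inl ?_⟩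
  obtain ⟨f, -, hf⟩ := h.2
  exact ⟨f, hf, Reach.validPos hG (hp.tail h)⟩

/-- Every play of `Γ_G` from `p` consistent with `sE` reaches a position in `T_E`. -/
def WinsFrom (sE : G.Pos → G.A) (p : G.Pos) : Prop :=
  ∀ ps : ℕ → G.Pos, ps 0 = p →
    (∀ k, G.EveNext G.ValidPos sE (ps k) (ps (k + 1))) → ∃ k, G.inTE (ps k)

theorem Reach.winsFrom {sE : G.Pos → G.A} (hG : G.LimitedObs)
    (hwin : G.EveWinningR G.ValidPos sE) {p : G.Pos} (hp : Reach sE p) :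
    WinsFrom sE p := by
  induction hp with
  | refl => exact hwin
  | @tail p p' hp hnext ih =>
    rintro ps rfl hps
    obtain ⟨k, hk⟩ := ih (fun k => Nat.casesOn k p ps) rfl (by
      rintro (_ | k)
      · exact hnext.eveNext hG hp
      · exact hps k)
    cases k with
    | zero => exact absurd (Or.inl hk) hnext.1
    | succ k => exact ⟨k, hk⟩

theorem WinsFrom.inTE_of_terminalPos {sE : G.Pos → G.A} {p : G.Pos} (hp : WinsFrom sE p)
    (ht : G.TerminalPos p) : G.inTE p := by
  obtain ⟨-, h⟩ := hp (fun _ => p) rfl fun _ => ⟨fun _ => rfl, fun h => absurd ht h⟩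
  exact h

theorem finite_reach {sE : G.Pos → G.A} (hG : G.LimitedObs)
    (hwin : G.EveWinningR G.ValidPos sE) : {p | Reach sE p}.Finite := by
  by_contra hinf
  have key (p : {p // Reach sE p ∧
      ¬ {p' | Relation.ReflTransGen (ProperNext sE) p p'}.Finite}) :
      ∃ p' : {p // Reach sE p ∧
        ¬ {p' | Relation.ReflTransGen (ProperNext sE) p p'}.Finite},
        ProperNext sE p.1 p'.1 := by
    obtain ⟨p, hp, hpinf⟩ := p
    by_contra! hno
    refine hpinf (((Set.finite_singleton p).union
      ((finite_properNext sE p).biUnion (t := fun p' =>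
        {p'' | Relation.ReflTransGen (ProperNext sE) p' p''}) fun p' hp' => ?_)).subset ?_)
    · by_contra hfin
      exact hno ⟨p', hp.tail hp', hfin⟩ hp'
    · intro p'' hp''
      rcases Relation.ReflTransGen.cases_head hp'' with rfl | ⟨p', h, h'⟩
      · exact Or.inl rfl
      · exact Or.inr (Set.mem_biUnion h h')
  choose next hnext using key
  let ps (k : ℕ) := next^[k] ⟨G.initPos, .refl, hinf⟩
  have hps (k : ℕ) : ProperNext sE (ps k).1 (ps (k + 1)).1 := by
    simp only [ps, Function.iterate_succ_apply']
    exact hnext _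
  obtain ⟨k, hk⟩ := hwin (fun k => (ps k).1) rfl fun k => (hps k).eveNext hG (ps k).2.1
  exact (hps k).1 (Or.inl hk)

/-- The reachable nonterminal positions, which serve as Eve's memory. -/
def Live (sE : G.Pos → G.A) : Set G.Pos := {p | Reach sE p ∧ ¬ G.TerminalPos p}

theorem exists_live_succ {sE : G.Pos → G.A} (hG : G.LimitedObs)
    (hwin : G.EveWinningR G.ValidPos sE) (p : Live sE) (o : Set G.Q) :
    ∃ p' : Live sE, o ∈ G.Obs → o ⊆ G.post (G.Fsupp p.1.2) (sE p.1) →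
      G.Fsupp p'.1.2 = o ∧ ∀ q v, ∀ q' ∈ o, p.1.2 q = some v → G.delta q (sE p.1) q' →
        ∃ v', p'.1.2 q' = some v' ∧ v' ≤ v + (G.w q (sE p.1) q' : WithTop ℤ) := by
  by_cases ho : o ∈ G.Obs ∧ o ⊆ G.post (G.Fsupp p.1.2) (sE p.1)
  swap
  · exact ⟨p, fun h₁ h₂ => absurd ⟨h₁, h₂⟩ ho⟩
  obtain ⟨f, hf, rfl⟩ := exists_isProperSucc p.1.2 (sE p.1) ho.1 ho.2
  have hreach : Reach sE (G.extend p.1 (sE p.1) f) := p.2.1.tail ⟨p.2.2, f, hf, rfl⟩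
  have hle : ∀ q v, ∀ q' ∈ G.Fsupp f, p.1.2 q = some v → G.delta q (sE p.1) q' →
      ∃ v', f q' = some v' ∧ v' ≤ v + (G.w q (sE p.1) q' : WithTop ℤ) := by
    intro q v q' hq' hv hd
    obtain ⟨m, hm, hmin⟩ := hf.2 q' hq'
    exact ⟨m, hm, hmin.2 _ ⟨q, v, hv, hd, rfl⟩⟩
  by_cases ht : G.TerminalPos (G.extend p.1 (sE p.1) f)
  · obtain ⟨i, hi, hsupp, hprec⟩ := (hreach.winsFrom hG hwin).inTE_of_terminalPos ht
    obtain ⟨p', hp', hnt, hp'i⟩ := hreach.exists_prefix i hi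
    rw [← hp'i] at hsupp hprec
    refine ⟨⟨p', hp', hnt⟩, fun _ _ => ⟨hsupp, fun q v q' hq' hv hd => ?_⟩⟩
    obtain ⟨m, hm, hmle⟩ := hle q v q' hq' hv hd
    obtain ⟨u, u', hu, hu', huu'⟩ := hprec q' (hsupp.symm ▸ hq')
    obtain rfl : u' = m := Option.some.inj (hu'.symm.trans hm)
    refine ⟨u, hu, le_trans ?_ hmle⟩
    simpa using huu'
  · exact ⟨⟨_, hreach, ht⟩, fun _ _ => ⟨rfl, hle⟩⟩

theorem exists_le_of_finite {S : Set G.Pos} (hS : S.Finite) :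
    ∃ B : ℤ, ∀ p ∈ S, ∀ q, ∀ v : ℤ, p.2 q = some (v : WithTop ℤ) → B ≤ v := by
  have := G.fintypeQ
  have hfin : (⋃ p ∈ S, ⋃ q, {v : ℤ | p.2 q = some (v : WithTop ℤ)}).Finite := by
    refine hS.biUnion fun p _ => Set.finite_iUnion fun q => Set.Subsingleton.finite ?_
    intro v hv v' hv'
    exact WithTop.coe_injective (Option.some.inj (hv.symm.trans hv'))
  obtain ⟨B, hB⟩ := hfin.bddBelow
  refine ⟨B, fun p hp q v hv => hB ?_⟩
  simp only [Set.mem_iUnion]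
  exact ⟨p, hp, q, hv⟩

theorem eq_of_mem_obs {o o' : Set G.Q} (ho : o ∈ G.Obs) (ho' : o' ∈ G.Obs) {q : G.Q}
    (hq : q ∈ o) (hq' : q ∈ o') : o = o' :=
  (G.partition.2 q).unique ⟨ho, hq⟩ ⟨ho', hq'⟩

theorem subset_post_of_mem (hG : G.LimitedObs) {o o' : Set G.Q} {a : G.A} {q : G.Q}
    (ho : o ∈ G.Obs) (ho' : o' ∈ G.Obs) (hq : q ∈ o') (hpost : q ∈ G.post o a) :
    o' ⊆ G.post o a := by
  obtain ⟨S, hS, hSeq⟩ := hG.2 o ho a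
  rw [hSeq] at hpost ⊢
  obtain ⟨o'', ho'', hq''⟩ := hpost
  rw [eq_of_mem_obs ho' (hS ho'') hq hq'']
  exact Set.subset_sUnion_of_mem ho''

theorem hist_succ (ψ : ℕ → Set G.Q × G.A) (i : ℕ) :
    G.hist ψ (i + 1) = G.hist ψ i ++ [ψ i] := by
  simp [hist, List.range_succ]

end MPG

/-- strategy transfer for Eve. -/
theorem eve_strategy_transfer (G : MPG) (hG : G.LimitedObs)
    (h : ∃ sE : G.Pos → G.A, G.EveWinningR G.ValidPos sE) :
    ∃ st : G.EveStrategy, (∃ m : ℕ, G.HasMemory st m) ∧ G.EveWinningStrategy st := by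
  obtain ⟨sE, hwin⟩ := h
  have hfin : (MPG.Live sE).Finite := (MPG.finite_reach hG hwin).subset fun p hp => hp.1
  choose step hstep using MPG.exists_live_succ hG hwin
  let start : MPG.Live sE := ⟨G.initPos, .refl, MPG.not_terminalPos_initPos⟩
  let cur (m : Option (MPG.Live sE)) (o : Set G.Q) : MPG.Live sE :=
    m.elim start fun p => step p o
  let mem (l : List (Set G.Q × G.A)) : Option (MPG.Live sE) :=
    l.foldl (fun x p => some (cur x p.1)) none
  have : Fintype (MPG.Live sE) := hfin.fintype
  refine ⟨fun l o => sE (cur (mem l) o).1, ⟨_, Option (MPG.Live sE), inferInstance, none,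
    fun x o => some (cur x o), fun x o => sE (cur x o).1, rfl, fun _ _ _ => rfl⟩, ?_⟩
  intro ψ hψ hcons π hπ
  let pos (i : ℕ) : MPG.Live sE := cur (mem (G.hist ψ i)) (ψ i).1
  have hpos0 : pos 0 = start := rfl
  have hpos (i : ℕ) : pos (i + 1) = step (pos i) (ψ (i + 1)).1 := by
    simp [pos, mem, MPG.hist_succ, List.foldl_append, cur]
  have hact (i : ℕ) : (ψ i).2 = sE (pos i).1 := hcons i
  have hψ0 : (ψ 0).1 = {G.qI} :=
    MPG.eq_of_mem_obs (hψ.1.1 0) hG.1 hψ.2 (Set.mem_singleton _)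
  have hpost (i : ℕ) : (ψ (i + 1)).1 ⊆ G.post (ψ i).1 (ψ i).2 := by
    obtain ⟨q, hq, q', hq', hd⟩ := hψ.1.2 i
    exact MPG.subset_post_of_mem hG (hψ.1.1 i) (hψ.1.1 (i + 1)) hq' ⟨q, hq, hd⟩
  have hinv (i : ℕ) : G.Fsupp (pos i).1.2 = (ψ i).1 ∧
      ∃ v, (pos i).1.2 (π i).1 = some v ∧ v ≤ (G.sumW π i : WithTop ℤ) := by
    induction i with
    | zero =>
      have hπ0 : (π 0).1 = G.qI := by
        have := (hπ.2 0).1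
        rwa [hψ0] at this
      refine ⟨by rw [hpos0, hψ0]; exact MPG.fsupp_fI, 0, ?_, by simp [MPG.sumW]⟩
      rw [hpos0, hπ0]
      simp [start, MPG.initPos, MPG.fI]
    | succ i ih =>
      obtain ⟨hsupp, v, hv, hle⟩ := ih
      obtain ⟨hsupp', hval⟩ := hstep (pos i) (ψ (i + 1)).1 (hψ.1.1 (i + 1))
        (by rw [hsupp, ← hact]; exact hpost i)
      have hd := hπ.1 i
      rw [(hπ.2 i).2, hact] at hd
      obtain ⟨v', hv', hle'⟩ := hval (π i).1 v (π (i + 1)).1 (hπ.2 (i + 1)).1 hv hd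
      refine ⟨hpos i ▸ hsupp', v', hpos i ▸ hv', hle'.trans ?_⟩
      rw [MPG.sumW, Finset.sum_range_succ, WithTop.coe_add, (hπ.2 i).2, hact]
      gcongr
      exact hle
  obtain ⟨B, hB⟩ := MPG.exists_le_of_finite hfin
  refine G.MP_nonneg_of_le_sumW π B fun n => ?_
  obtain ⟨-, v, hv, hle⟩ := hinv n
  lift v to ℤ using fun h => (pos n).2.1.ne_top _ (h ▸ hv)
  exact (hB _ (pos n).2 _ v hv).trans (by exact_mod_cast hle)
end

section
/- There exists a polynomial p such that for every n ∈ ℕ there is a forcibly FAC MPG with limited-observation G_n with at most p(n) states in which Eve has a winning observation-based strategy, but every winning observation-based strategy of Eve in G_n has memory at least 2^n. -/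
open Classical

/-! The copying game: in every round Adam announces `n + 1` bits one by one, and Eve then has to
repeat all of them. Adam secretly holds a pair `(j, v)`: a position `j` and a guess `v` of the
bit at that position. -/
namespace CopyGame

/-- States: `none` is initial, `some (i, b, j, v)` says that the `i`-th announced bit is `b`
and that the hidden pair is `(j, v)`. -/
abbrev State (n : ℕ) : Type := Option (Fin (n + 1) × Bool × Fin (n + 1) × Bool)

abbrev Act (n : ℕ) : Type := Fin (n + 1) → Bool

variable {n : ℕ}

/-- What Eve sees of a state. -/
def key : State n → Option (Fin (n + 1) × Bool)
  | none => none
  | some (i, b, _, _) => some (i, b)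

def Step : State n → State n → Prop
  | none, none => False
  | none, some (i, _, _, _) => i.val = 0
  | some (i, _, _, _), none => i.val = n
  | some (i, _, j, v), some (i', _, j', v') => i'.val = i.val + 1 ∧ j = j' ∧ v = v'

def weight : State n → Act n → ℤ
  | none, _ => 0
  | some (i, b, j, v), a =>
    (if i = j ∧ b ≠ v then 1 else 0) - (if i.val = n ∧ a j ≠ v then 1 else 0)

theorem step_total (q : State n) : ∃ q', Step q q' := by
  rcases q with _ | ⟨i, b, j, v⟩
  · exact ⟨some (0, true, 0, true), rfl⟩
  · by_cases h : i.val = n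
    · exact ⟨none, h⟩
    · exact ⟨some (⟨i.val + 1, by omega⟩, true, j, v), rfl, rfl, rfl⟩

end CopyGame

open CopyGame in
/-- The copying game with `n + 1` bits. -/
noncomputable def copyGame (n : ℕ) : MPG where
  Q := State n
  A := Act n
  fintypeQ := inferInstance
  decEqQ := inferInstance
  fintypeA := inferInstance
  nonemptyA := inferInstance
  qI := none
  delta q _ q' := Step q q'
  total q _ := step_total q
  w q a _ := weight q a
  Obs := (Setoid.ker (key (n := n))).classes
  partition := Setoid.isPartition_classes _

namespace CopyGame

variable {n : ℕ}

theorem mem_obs_iff {o : Set (State n)} :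
    o ∈ (copyGame n).Obs ↔ ∃ q₀ : State n, o = {q | key q = key q₀} := Iff.rfl

theorem mem_obs_of_key_eq {o : Set (State n)} (ho : o ∈ (copyGame n).Obs) {q q' : State n}
    (hq : q ∈ o) (h : key q' = key q) : q' ∈ o := by
  obtain ⟨q₀, rfl⟩ := mem_obs_iff.1 ho
  exact h.trans hq

theorem key_eq_of_mem_obs {o : Set (State n)} (ho : o ∈ (copyGame n).Obs) {q q' : State n}
    (hq : q ∈ o) (hq' : q' ∈ o) : key q = key q' := by
  obtain ⟨q₀, rfl⟩ := mem_obs_iff.1 ho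
  exact Eq.trans hq (Eq.symm hq')

theorem obs_nonempty {o : Set (State n)} (ho : o ∈ (copyGame n).Obs) : o.Nonempty := by
  obtain ⟨q₀, rfl⟩ := mem_obs_iff.1 ho
  exact ⟨q₀, rfl⟩

theorem key_eq_none {q : State n} : key q = none ↔ q = none := by
  rcases q with _ | ⟨i, b, j, v⟩ <;> simp [key]

theorem singleton_none_mem_obs : ({none} : Set (State n)) ∈ (copyGame n).Obs := by
  refine mem_obs_iff.2 ⟨none, ?_⟩
  ext q
  exact key_eq_none.symm

theorem limitedObs : (copyGame n).LimitedObs := by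
  refine ⟨singleton_none_mem_obs, fun o ho a => ?_⟩
  refine ⟨{o' | o' ∈ (copyGame n).Obs ∧ o' ⊆ (copyGame n).post o a}, fun _ h => h.1, ?_⟩
  apply Set.Subset.antisymm
  · rintro q' ⟨q, hq, hs⟩
    refine ⟨{x : State n | key x = key q'}, ⟨mem_obs_iff.2 ⟨q', rfl⟩, ?_⟩, rfl⟩
    intro q'' h
    change key q'' = key q' at h
    change Step q q' at hs
    rcases q' with _ | ⟨i', b', j', v'⟩
    · rw [key_eq_none.1 h]
      exact ⟨q, hq, hs⟩
    · rcases q'' with _ | ⟨i, b, j, v⟩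
      · simp [key] at h
      · simp only [key, Option.some.injEq, Prod.mk.injEq] at h
        obtain ⟨rfl, rfl⟩ := h
        rcases q with _ | ⟨i₀, b₀, j₀, v₀⟩
        · exact ⟨none, hq, hs⟩
        · exact ⟨some (i₀, b₀, j, v), mem_obs_of_key_eq ho hq rfl, hs.1, rfl, rfl⟩
  · rintro q ⟨o', ⟨_, h⟩, hq⟩
    exact h hq

/-- The bit announced at position `i` by the observation `o`. -/
noncomputable def obsBit (o : Set (State n)) (i : Fin (n + 1)) : Bool :=
  decide (∃ j v, some (i, true, j, v) ∈ o)

theorem obsBit_eq {o : Set (State n)} (ho : o ∈ (copyGame n).Obs) {i b j v}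
    (h : some (i, b, j, v) ∈ o) : obsBit o i = b := by
  cases b
  · simp only [obsBit, decide_eq_false_iff_not]
    rintro ⟨j', v', h'⟩
    have := key_eq_of_mem_obs ho h h'
    simp [key] at this
  · simp only [obsBit, decide_eq_true_eq]
    exact ⟨j, v, h⟩

/-- Weight collected since the start of the round when the announced bits are `β`. -/
def potential (β : Act n) : State n → ℤ
  | none => 0
  | some (i, _, j, v) => if j.val < i.val ∧ β j ≠ v then 1 else 0

theorem potential_nonneg (β : Act n) (q : State n) : 0 ≤ potential β q := by
  rcases q with _ | ⟨i, b, j, v⟩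
  · exact le_rfl
  · simp only [potential]
    split_ifs <;> simp

theorem potential_congr {β β' : Act n} {i : Fin (n + 1)} {b j v}
    (h : ∀ j : Fin (n + 1), j.val < i.val → β j = β' j) :
    potential β (some (i, b, j, v)) = potential β' (some (i, b, j, v)) := by
  simp only [potential]
  by_cases hj : j.val < i.val
  · rw [h j hj]
  · simp [hj]

theorem potential_none_step {β β' : Act n} {q' : State n} {a : Act n} (h : Step none q') :
    potential β none + weight none a = potential β' q' := by
  rcases q' with _ | ⟨i', b', j', v'⟩
  · exact h.elim
  · change i'.val = 0 at h
    simp [potential, weight, h]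

theorem potential_some_step {β : Act n} {i b j v} {q' : State n} {a : Act n}
    (h : Step (some (i, b, j, v)) q') (hb : β i = b) (ha : i.val = n → a = β) :
    potential β (some (i, b, j, v)) + weight (some (i, b, j, v)) a = potential β q' := by
  have hij : i = j ↔ i.val = j.val := Fin.ext_iff
  have hj := j.isLt
  rcases q' with _ | ⟨i', b', j', v'⟩
  · change i.val = n at h
    rw [ha h]
    by_cases hv : β j = v
    · have : ¬ (i = j ∧ b ≠ v) := by
        rintro ⟨rfl, h'⟩
        exact h' (hb.symm.trans hv)
      simp [potential, weight, this, hv]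
    · by_cases e : i = j
      · subst e
        have : b ≠ v := fun h' => hv (hb.trans h')
        simp [potential, weight, h, hv, this]
      · have : j.val < n := by rw [hij] at e; omega
        simp [potential, weight, h, hv, e, this]
  · obtain ⟨h1, rfl, rfl⟩ := h
    have hi : i.val ≠ n := by have := i'.isLt; omega
    by_cases e : i = j
    · subst e
      simp [potential, weight, hi, h1, hb]
    · have : j.val < i.val + 1 ↔ j.val < i.val := by rw [hij] at e; omega
      simp [potential, weight, hi, h1, e, this]

/-- Eve's strategy of repeating the last `n + 1` announced bits. -/
noncomputable def copyStrategy (n : ℕ) : (copyGame n).EveStrategy :=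
  fun (h : List (Set (State n) × Act n)) (o : Set (State n)) (j : Fin (n + 1)) =>
    obsBit ((h.map Prod.fst ++ [o]).getD (h.length - n + j.val) ∅) j

theorem copyStrategy_hist (ψ : ℕ → Set (State n) × Act n) {k : ℕ} (hk : n ≤ k)
    (j : Fin (n + 1)) :
    copyStrategy n ((copyGame n).hist ψ k) (ψ k).1 j = obsBit (ψ (k - n + j.val)).1 j := by
  have hl : ((List.range k).map ψ).map Prod.fst ++ [(ψ k).1]
      = (List.range (k + 1)).map fun i => (ψ i).1 := by
    rw [List.range_succ, List.map_append]
    simp [Function.comp_def]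
  have hj : k - n + j.val < k + 1 := by omega
  change obsBit ((((List.range k).map ψ).map Prod.fst ++ [(ψ k).1]).getD
    (((List.range k).map ψ).length - n + j.val) ∅) j = _
  rw [hl, List.length_map, List.length_range, List.getD_eq_getElem?_getD]
  simp [hj]

theorem copyStrategy_winning : (copyGame n).EveWinningStrategy (copyStrategy n) := by
  intro ψ hplay hcons π hπ
  obtain ⟨hpath, hmem⟩ := hπ
  have hobs := hplay.1.1
  have h0 : (π 0).1 = none := by
    have := key_eq_of_mem_obs (hobs 0) (hmem 0).1 hplay.2
    exact key_eq_none.1 this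
  have inv : ∀ k, (∀ i b j v, (π k).1 = some (i, b, j, v) → i.val < k ∧
        (copyGame n).sumW π k =
          potential (fun l => obsBit (ψ (k - i.val + l.val)).1 l) (some (i, b, j, v))) ∧
      ((π k).1 = none → (copyGame n).sumW π k = 0) := by
    intro k
    induction k with
    | zero =>
      refine ⟨fun i b j v h => ?_, fun _ => by simp [MPG.sumW]⟩
      rw [h0] at h
      cases h
    | succ k ih =>
      have hs : Step (π k).1 (π (k + 1)).1 := hpath k
      have hsum : (copyGame n).sumW π (k + 1)
          = (copyGame n).sumW π k + weight (π k).1 (π k).2 := by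
        simp only [MPG.sumW]
        rw [Finset.sum_range_succ]
        rfl
      rw [hsum]
      have hm := (hmem k).1
      rcases hq : (π k).1 with _ | ⟨i, b, j, v⟩
      · rw [hq] at hs
        rw [ih.2 hq]
        constructor
        · intro i' b' j' v' h'
          rw [h'] at hs
          refine ⟨?_, potential_none_step (β := fun _ => true) hs⟩
          change i'.val = 0 at hs
          omega
        · intro h'
          rw [h'] at hs
          exact hs.elim
      · rw [hq] at hs hm
        obtain ⟨hik, hS⟩ := ih.1 i b j v hq
        rw [hS]
        have hb : obsBit (ψ (k - i.val + i.val)).1 i = b := by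
          rw [Nat.sub_add_cancel hik.le]
          exact obsBit_eq (hobs k) hm
        have ha : i.val = n →
            (π k).2 = fun l => obsBit (ψ (k - i.val + l.val)).1 l := by
          intro hi
          rw [(hmem k).2, hcons k, hi]
          funext l
          exact copyStrategy_hist ψ (by omega) l
        have key := potential_some_step
          (β := fun l => obsBit (ψ (k - i.val + l.val)).1 l) hs hb ha
        rw [key]
        constructor
        · intro i' b' j' v' h'
          rw [h'] at hs ⊢
          have h1 := hs.1
          refine ⟨by omega, ?_⟩
          rw [show k + 1 - i'.val = k - i.val by omega]
        · intro h'
          rw [h']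
          rfl
  have hnn : ∀ k, 0 ≤ (copyGame n).sumW π k := by
    intro k
    rcases hq : (π k).1 with _ | ⟨i, b, j, v⟩
    · exact ((inv k).2 hq).ge
    · rw [((inv k).1 i b j v hq).2]
      exact potential_nonneg _ _
  have hle : ∀ k, (copyGame n).sumW π k ≤ k := by
    intro k
    induction k with
    | zero => simp [MPG.sumW]
    | succ k ih =>
      have hw : weight (π k).1 (π k).2 ≤ 1 := by
        rcases (π k).1 with _ | ⟨i, b, j, v⟩
        · simp [weight]
        · simp only [weight]
          split_ifs <;> simp
      have hsum : (copyGame n).sumW π (k + 1)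
          = (copyGame n).sumW π k + weight (π k).1 (π k).2 := by
        simp only [MPG.sumW]
        rw [Finset.sum_range_succ]
        rfl
      push_cast
      omega
  refine Filter.le_liminf_of_le ?_ (Filter.Eventually.of_forall fun k => ?_)
  · refine Filter.IsBoundedUnder.isCoboundedUnder_ge ⟨1, ?_⟩
    refine Filter.eventually_map.2 (Filter.Eventually.of_forall fun k => ?_)
    have : ((copyGame n).sumW π k : ℝ) ≤ k := by exact_mod_cast hle k
    exact div_le_one_of_le₀ this (Nat.cast_nonneg k)
  · have : (0 : ℝ) ≤ (copyGame n).sumW π k := by exact_mod_cast hnn k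
    positivity

/-- The observation class at time `t` of a round in which Adam announces `β`. -/
def keyAt (β : Act n) : ℕ → Option (Fin (n + 1) × Bool)
  | 0 => none
  | t + 1 => if h : t < n + 1 then some (⟨t, h⟩, β ⟨t, h⟩) else none

/-- The state at time `t` of a round in which Adam announces `β` and holds `(j, β j)`. -/
def stateAt (β : Act n) (j : Fin (n + 1)) : ℕ → State n
  | 0 => none
  | t + 1 => if h : t < n + 1 then some (⟨t, h⟩, β ⟨t, h⟩, j, β j) else none

theorem key_stateAt (β : Act n) (j : Fin (n + 1)) (t : ℕ) :
    key (stateAt β j t) = keyAt β t := by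
  rcases t with _ | t
  · rfl
  · simp only [stateAt, keyAt]
    split_ifs <;> rfl

theorem step_stateAt (β : Act n) (j : Fin (n + 1)) {t : ℕ} (ht : t ≤ n) :
    Step (stateAt β j t) (stateAt β j (t + 1)) := by
  rcases t with _ | t
  · simp [stateAt, Step]
  · have h1 : t < n + 1 := by omega
    have h2 : t + 1 < n + 1 := by omega
    simp [stateAt, Step, h1, h2]

theorem step_stateAt_last (β : Act n) (j : Fin (n + 1)) :
    Step (stateAt β j (n + 1)) none := by
  simp [stateAt, Step]

theorem weight_stateAt (β : Act n) (j : Fin (n + 1)) {t : ℕ} (ht : t ≤ n) (a : Act n) :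
    weight (stateAt β j t) a = 0 := by
  rcases t with _ | t
  · rfl
  · have h1 : t < n + 1 := by omega
    have h2 : t ≠ n := by omega
    simp only [stateAt, h1, weight, h2, dif_pos, false_and, if_false, sub_zero,
      ite_eq_right_iff]
    rintro ⟨rfl, h⟩
    exact absurd rfl h

theorem weight_stateAt_last (β : Act n) (j : Fin (n + 1)) {a : Act n} (ha : a j ≠ β j) :
    weight (stateAt β j (n + 1)) a = -1 := by
  have : ¬ ((⟨n, n.lt_succ_self⟩ : Fin (n + 1)) = j ∧ β ⟨n, n.lt_succ_self⟩ ≠ β j) := by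
    rintro ⟨rfl, h⟩
    exact h rfl
  simp only [stateAt, n.lt_succ_self, weight, dif_pos]
  rw [if_neg this, if_pos ⟨trivial, ha⟩]
  rfl

/-- The observation at time `t` of a round in which Adam announces `β`. -/
def obsAt (β : Act n) (t : ℕ) : Set (State n) := {q | key q = keyAt β t}

theorem stateAt_mem_obsAt (β : Act n) (j : Fin (n + 1)) (t : ℕ) :
    stateAt β j t ∈ obsAt β t := key_stateAt β j t

theorem obsAt_mem_obs (β : Act n) (t : ℕ) : obsAt β t ∈ (copyGame n).Obs :=
  mem_obs_iff.2 ⟨stateAt β 0 t, by rw [key_stateAt]; rfl⟩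

/-- Eve's memory at time `t` of a round which starts with memory `y`. -/
def memAt {M : Type} (αu : M → Set (State n) → M) (β : Act n) (y : M) : ℕ → M
  | 0 => y
  | t + 1 => αu (memAt αu β y t) (obsAt β t)

theorem exists_wrong_response {M : Type} [Fintype M] (hM : Fintype.card M < 2 ^ n)
    (αu : M → Set (State n) → M) (αo : M → Set (State n) → Act n) (y : M) :
    ∃ (β : Act n) (j : Fin (n + 1)),
      αo (memAt αu β y (n + 1)) (obsAt β (n + 1)) j ≠ β j := by
  by_contra! h
  have hinj : Function.Injective
      fun β : Act n => (memAt αu β y (n + 1), β (Fin.last n)) := by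
    intro β β' e
    simp only [Prod.mk.injEq] at e
    have ho : obsAt β (n + 1) = obsAt β' (n + 1) := by
      have hk : keyAt β (n + 1) = keyAt β' (n + 1) := by
        simp only [keyAt, n.lt_succ_self, dif_pos]
        rw [show (⟨n, n.lt_succ_self⟩ : Fin (n + 1)) = Fin.last n from rfl, e.2]
      simp only [obsAt, hk]
    funext j
    rw [← h β j, ← h β' j, e.1, ho]
  have := Fintype.card_le_of_injective _ hinj
  simp only [Fintype.card_pi, Fintype.card_bool, Finset.prod_const, Finset.card_univ,
    Fintype.card_fin, Fintype.card_prod, pow_succ] at this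
  omega

theorem liminf_neg_of_round {s : ℕ → ℤ} {t : ℕ → ℕ} (ht : ∀ k, t k ≤ n + 1)
    (h : ∀ k, ((n : ℤ) + 2) * s k + k = t k) :
    Filter.liminf (fun k => (s k : ℝ) / (k : ℝ)) Filter.atTop < 0 := by
  have hn : (0 : ℝ) < n + 2 := by positivity
  have hs : ∀ k, ((n : ℝ) + 2) * s k + k = t k := fun k => by exact_mod_cast h k
  have hlt : -(1 / (2 * ((n : ℝ) + 2))) < 0 := by
    have : 0 < 1 / (2 * ((n : ℝ) + 2)) := by positivity
    linarith
  refine lt_of_le_of_lt (Filter.liminf_le_of_le ?_ fun b hb => ?_) hlt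
  · refine ⟨-1, Filter.eventually_map.2 (Filter.Eventually.of_forall fun k => ?_)⟩
    rcases Nat.eq_zero_or_pos k with rfl | hk
    · simp
    · have hk' : (0 : ℝ) < k := by exact_mod_cast hk
      change -1 ≤ (s k : ℝ) / k
      rw [le_div_iff₀ hk']
      have h0 : (0 : ℝ) ≤ t k := Nat.cast_nonneg _
      have hn0 : (0 : ℝ) ≤ n := Nat.cast_nonneg _
      have := hs k
      nlinarith
  · obtain ⟨k, hk, hkn⟩ := (hb.and (Filter.eventually_ge_atTop (2 * (n + 1) + 1))).exists
    refine hk.trans ?_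
    have hkn' : 2 * ((n : ℝ) + 1) + 1 ≤ k := by exact_mod_cast hkn
    have hn0 : (0 : ℝ) ≤ n := Nat.cast_nonneg _
    have hk' : (0 : ℝ) < k := by linarith
    have htk : (t k : ℝ) ≤ n + 1 := by exact_mod_cast ht k
    have := hs k
    rw [← neg_div, div_le_div_iff₀ hk' (by positivity)]
    nlinarith

theorem memory_lower_bound {st : (copyGame n).EveStrategy}
    (hst : (copyGame n).EveWinningStrategy st) {m : ℕ} (hm : (copyGame n).HasMemory st m) :
    2 ^ n ≤ m := by
  by_contra! hlt
  obtain ⟨M, inst, m0, αu, αo, hcard, hmem⟩ := hm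
  change M → Set (State n) → M at αu
  change M → Set (State n) → Act n at αo
  choose β J hβ using exists_wrong_response (hcard.trans_lt hlt) αu αo
  let next : M × ℕ → M × ℕ := fun c =>
    if c.2 = n + 1 then (memAt αu (β c.1) c.1 (n + 2), 0) else (c.1, c.2 + 1)
  let cfg : ℕ → M × ℕ := fun k => next^[k] (m0, 0)
  have cfg_succ : ∀ k, cfg (k + 1) = next (cfg k) := fun k =>
    Function.iterate_succ_apply' next k _
  have cfg_le : ∀ k, (cfg k).2 ≤ n + 1 := by
    intro k
    induction k with
    | zero => exact Nat.zero_le _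
    | succ k ih =>
      rw [cfg_succ]
      by_cases h : (cfg k).2 = n + 1
      · simp [next, h]
      · simp only [next, h, if_false]
        omega
  let ψ : ℕ → Set (State n) × Act n := fun k =>
    (obsAt (β (cfg k).1) (cfg k).2,
      αo (memAt αu (β (cfg k).1) (cfg k).1 (cfg k).2) (obsAt (β (cfg k).1) (cfg k).2))
  let π : ℕ → State n × Act n := fun k =>
    (stateAt (β (cfg k).1) (J (cfg k).1) (cfg k).2, (ψ k).2)
  have hstep : ∀ k, Step (π k).1 (π (k + 1)).1 := by
    intro k
    simp only [π, cfg_succ]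
    by_cases h : (cfg k).2 = n + 1
    · simp only [next, h, if_true]
      exact step_stateAt_last _ _
    · simp only [next, h, if_false]
      exact step_stateAt _ _ (by have := cfg_le k; omega)
  have hπψ : ∀ k, (π k).1 ∈ (ψ k).1 := fun k => stateAt_mem_obsAt _ _ _
  have hplay : (copyGame n).IsPlay ψ :=
    ⟨⟨fun k => obsAt_mem_obs _ _, fun k => ⟨_, hπψ k, _, hπψ (k + 1), hstep k⟩⟩, hπψ 0⟩
  have hfold : ∀ k, ((List.range k).map ψ).foldl (fun x (p : Set (State n) × Act n) => αu x p.1) m0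
      = memAt αu (β (cfg k).1) (cfg k).1 (cfg k).2 := by
    intro k
    induction k with
    | zero => rfl
    | succ k ih =>
      rw [List.range_succ, List.map_append, List.foldl_append, ih, cfg_succ]
      by_cases h : (cfg k).2 = n + 1
      · simp only [next, h, if_true, List.map_cons, List.map_nil, List.foldl_cons, List.foldl_nil, ψ]
        rfl
      · simp only [next, h, if_false, List.map_cons, List.map_nil, List.foldl_cons, List.foldl_nil, ψ]
        rfl
  have hcons : (copyGame n).ConsistentE st ψ := by
    intro k
    rw [hmem ψ hplay k]
    exact congrArg (fun x => αo x (ψ k).1) (hfold k).symm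
  have hwin := hst ψ hplay hcons π ⟨hstep, fun k => ⟨hπψ k, rfl⟩⟩
  refine absurd hwin (not_le.2 (liminf_neg_of_round cfg_le fun k => ?_))
  induction k with
  | zero => simp [MPG.sumW, cfg]
  | succ k ih =>
    have hsum : (copyGame n).sumW π (k + 1)
        = (copyGame n).sumW π k + weight (π k).1 (π k).2 := by
      simp only [MPG.sumW]
      rw [Finset.sum_range_succ]
      rfl
    rw [hsum, cfg_succ]
    by_cases h : (cfg k).2 = n + 1
    · have hw : weight (π k).1 (π k).2 = -1 := by
        have := hβ (cfg k).1
        simp only [π, ψ, h]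
        exact weight_stateAt_last _ _ this
      simp only [next, h, if_true]
      rw [hw]
      rw [h] at ih
      push_cast at ih ⊢
      linarith
    · have hw : weight (π k).1 (π k).2 = 0 :=
        weight_stateAt _ _ (by have := cfg_le k; omega) _
      simp only [next, h, if_false]
      rw [hw]
      push_cast at ih ⊢
      linarith

/-- The time within a round at which a state is visited. -/
def level : State n → ℕ
  | none => 0
  | some (i, _, _, _) => i.val + 1

theorem level_step {q q' : State n} (h : Step q q') (hq : level q ≤ n) :
    level q' = level q + 1 := by
  rcases q with _ | ⟨i, b, j, v⟩ <;> rcases q' with _ | ⟨i', b', j', v'⟩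
  · exact h.elim
  · change i'.val = 0 at h
    simp [level, h]
  · change i.val = n at h
    simp only [level] at hq
    omega
  · simp [level, h.1]

theorem eq_none_of_step {q q' : State n} (h : Step q q') (hq : level q = n + 1) :
    q' = none := by
  rcases q with _ | ⟨i, b, j, v⟩
  · simp [level] at hq
  · rcases q' with _ | ⟨i', b', j', v'⟩
    · rfl
    · have := h.1
      have := i'.isLt
      simp only [level] at hq
      omega

theorem posFun_length (p : (copyGame n).Pos) : (copyGame n).posFun p p.1.length = p.2 := by
  simp [MPG.posFun]

theorem posFun_extend (p : (copyGame n).Pos) (a : Act n) (f : (copyGame n).FF) {i : ℕ}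
    (hi : i ≤ p.1.length) :
    (copyGame n).posFun ((copyGame n).extend p a f) i = (copyGame n).posFun p i := by
  rcases hi.lt_or_eq with h | rfl
  · have h' : i < p.1.length + 1 := by omega
    simp [MPG.posFun, MPG.extend, h, h']
  · simp [MPG.posFun, MPG.extend]

theorem length_extend (p : (copyGame n).Pos) (a : Act n) (f : (copyGame n).FF) :
    ((copyGame n).extend p a f).1.length = p.1.length + 1 := by
  simp [MPG.extend]

/-- The bits announced along a position in the first round. -/
noncomputable def posBits (p : (copyGame n).Pos) : Act n :=
  fun j => obsBit ((copyGame n).Fsupp ((copyGame n).posFun p (j.val + 1))) j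

/-- The positions reached in the first round when Eve copies: the `i`-th observation is visited
at time `i`, and the final function is bounded below by the weight collected so far. -/
structure FirstRound (p : (copyGame n).Pos) : Prop where
  valid : (copyGame n).ValidPos' p
  length_le : p.1.length ≤ n + 1
  obs : ∀ i ≤ p.1.length, (copyGame n).Fsupp ((copyGame n).posFun p i) ∈ (copyGame n).Obs
  level_eq : ∀ i ≤ p.1.length, ∀ q ∈ (copyGame n).Fsupp ((copyGame n).posFun p i), level q = i
  bound : ∀ (q : State n) (x : WithTop ℤ), p.2 q = some x →
    ((potential (posBits p) q : ℤ) : WithTop ℤ) ≤ x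

theorem FirstRound.supp_ne {p : (copyGame n).Pos} (hp : FirstRound p) {i j : ℕ} (hij : i < j)
    (hj : j ≤ p.1.length) :
    (copyGame n).Fsupp ((copyGame n).posFun p i) ≠
      (copyGame n).Fsupp ((copyGame n).posFun p j) := by
  intro h
  obtain ⟨q, hq⟩ := obs_nonempty (hp.obs i (hij.le.trans hj))
  have h1 := hp.level_eq i (hij.le.trans hj) q hq
  have h2 := hp.level_eq j hj q (h ▸ hq)
  omega

theorem FirstRound.not_terminal {p : (copyGame n).Pos} (hp : FirstRound p) :
    ¬ (copyGame n).TerminalPos p := by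
  rintro (⟨i, hi, h⟩ | ⟨i, hi, h, -⟩)
  · apply hp.supp_ne hi le_rfl
    rw [posFun_length]
    exact h.1
  · apply hp.supp_ne hi le_rfl
    rw [posFun_length]
    exact h.1.symm

theorem fsupp_fI : (copyGame n).Fsupp (copyGame n).fI = {none} := by
  ext q
  change (copyGame n).fI q ≠ none ↔ q = none
  simp only [MPG.fI]
  split_ifs with h
  · exact iff_of_true (Option.some_ne_none _) h
  · exact iff_of_false (fun h' => h' rfl) h

theorem firstRound_init : FirstRound (copyGame n).initPos where
  valid := ⟨⟨rfl, fun i hi => absurd hi (Nat.not_lt_zero _),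
    fun i j _ hj => absurd hj (Nat.not_lt_zero _)⟩,
    fun i j _ hj => absurd hj (Nat.not_lt_zero _)⟩
  length_le := Nat.zero_le _
  obs i _ := by
    change (copyGame n).Fsupp (copyGame n).fI ∈ _
    rw [fsupp_fI]
    exact singleton_none_mem_obs
  level_eq i hi q hq := by
    change q ∈ (copyGame n).Fsupp (copyGame n).fI at hq
    rw [fsupp_fI] at hq
    rw [Set.mem_singleton_iff.1 hq]
    exact (Nat.le_zero.1 hi).symm
  bound q x h := by
    change (copyGame n).fI q = some x at h
    have hq : q ∈ (copyGame n).Fsupp (copyGame n).fI := by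
      change (copyGame n).fI q ≠ none
      rw [h]
      simp
    rw [fsupp_fI] at hq
    obtain rfl := Set.mem_singleton_iff.1 hq
    have : (copyGame n).fI none = some ((0 : ℤ) : WithTop ℤ) := by
      simp only [MPG.fI]
      exact if_pos rfl
    rw [this] at h
    obtain rfl := Option.some.inj h
    exact le_rfl

theorem FirstRound.valid_extend {p : (copyGame n).Pos} (hp : FirstRound p) {a : Act n}
    {f : (copyGame n).FF} (hf : (copyGame n).IsSucc p.2 a f) :
    (copyGame n).ValidPos' ((copyGame n).extend p a f) := by
  have hne : ∀ i j, i < j → j < ((copyGame n).extend p a f).1.length →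
      (copyGame n).Fsupp ((copyGame n).posFun ((copyGame n).extend p a f) i) ≠
        (copyGame n).Fsupp ((copyGame n).posFun ((copyGame n).extend p a f) j) := by
    intro i j hij hj
    rw [length_extend] at hj
    rw [posFun_extend p a f (by omega), posFun_extend p a f (by omega)]
    exact hp.supp_ne hij (by omega)
  refine ⟨⟨?_, ?_, fun i j hij hj => ⟨fun h => hne i j hij hj h.1,
    fun h => hne i j hij hj h.1.symm⟩⟩, hne⟩
  · rw [posFun_extend p a f (Nat.zero_le _)]
    exact hp.valid.1.1
  · intro i hi
    have hi' := hi
    rw [length_extend] at hi'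
    rw [posFun_extend p a f (by omega)]
    rcases (Nat.lt_succ_iff.1 hi').lt_or_eq with h | rfl
    · rw [posFun_extend p a f (by omega)]
      have := hp.valid.1.2.1 i h
      simpa [MPG.extend, h] using this
    · have h1 : (copyGame n).posFun ((copyGame n).extend p a f) (p.1.length + 1) = f := by
        simp [MPG.posFun, MPG.extend]
      rw [h1, posFun_length]
      simpa [MPG.extend] using hf

theorem FirstRound.obs_last {p : (copyGame n).Pos} (hp : FirstRound p) :
    (copyGame n).Fsupp p.2 ∈ (copyGame n).Obs := by
  simpa only [posFun_length] using hp.obs p.1.length le_rfl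

theorem FirstRound.level_last {p : (copyGame n).Pos} (hp : FirstRound p) {q : State n}
    (hq : q ∈ (copyGame n).Fsupp p.2) : level q = p.1.length :=
  hp.level_eq p.1.length le_rfl q (by rwa [posFun_length])

theorem FirstRound.exists_extend {p : (copyGame n).Pos} (hp : FirstRound p) (a : Act n) :
    ∃ f, (copyGame n).ValidPos' ((copyGame n).extend p a f) := by
  obtain ⟨S, hS, hpost⟩ := limitedObs.2 _ hp.obs_last a
  obtain ⟨q, hq⟩ := obs_nonempty hp.obs_last
  obtain ⟨q', hq'⟩ := step_total q
  have hmem : q' ∈ ⋃₀ S := hpost ▸ ⟨q, hq, hq'⟩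
  obtain ⟨o, ho, -⟩ := hmem
  let f : (copyGame n).FF := fun x => if x ∈ o then some ⊤ else none
  have hsupp : (copyGame n).Fsupp f = o := by
    ext x
    simp [MPG.Fsupp, f]
  refine ⟨f, hp.valid_extend ⟨?_, ?_, fun x hx => ?_⟩⟩
  · rw [hsupp]
    exact hS ho
  · rw [hsupp, hpost]
    exact Set.subset_sUnion_of_mem ho
  · rw [hsupp] at hx
    exact Or.inl (if_pos hx)

theorem FirstRound.isSucc_of_valid {p : (copyGame n).Pos} {a : Act n} {f : (copyGame n).FF}
    (h : (copyGame n).ValidPos' ((copyGame n).extend p a f)) :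
    (copyGame n).IsSucc p.2 a f := by
  have hl : p.1.length < ((copyGame n).extend p a f).1.length := by
    rw [length_extend]
    omega
  have := h.1.2.1 p.1.length hl
  rw [posFun_extend p a f le_rfl, posFun_length] at this
  simpa [MPG.extend, MPG.posFun] using this

theorem FirstRound.bound_succ {p : (copyGame n).Pos} (hp : FirstRound p)
    {f : (copyGame n).FF} (hf : (copyGame n).IsSucc p.2 (posBits p) f) (q' : State n)
    (x : WithTop ℤ) (hx : f q' = some x) :
    ((potential (posBits p) q' : ℤ) : WithTop ℤ) ≤ x := by
  have hq' : q' ∈ (copyGame n).Fsupp f := by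
    change f q' ≠ none
    rw [hx]
    simp
  rcases hf.2.2 q' hq' with h | ⟨m, hm, ⟨q, v, hqv, hs, rfl⟩, -⟩
  · rw [hx] at h
    rw [Option.some.inj h]
    exact le_top
  · rw [hx] at hm
    obtain rfl := Option.some.inj hm
    change Step q q' at hs
    have hq : q ∈ (copyGame n).Fsupp p.2 := by
      change p.2 q ≠ none
      rw [hqv]
      simp
    have hpot : potential (posBits p) q + weight q (posBits p) = potential (posBits p) q' := by
      rcases q with _ | ⟨i, b, j, v'⟩
      · exact potential_none_step hs
      · refine potential_some_step hs ?_ fun _ => rfl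
        have hlev : i.val + 1 = p.1.length := hp.level_last hq
        simp only [posBits]
        rw [hlev, posFun_length]
        exact obsBit_eq hp.obs_last hq
    rw [← hpot, WithTop.coe_add]
    exact add_le_add (hp.bound q v hqv) le_rfl

theorem FirstRound.extend {p : (copyGame n).Pos} (hp : FirstRound p) (hlen : p.1.length ≤ n)
    {f : (copyGame n).FF}
    (h : (copyGame n).ValidPos' ((copyGame n).extend p (posBits p) f)) :
    FirstRound ((copyGame n).extend p (posBits p) f) := by
  have hf := FirstRound.isSucc_of_valid h
  have hlast : (copyGame n).posFun ((copyGame n).extend p (posBits p) f) (p.1.length + 1) = f := by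
    simp [MPG.posFun, MPG.extend]
  have hlev : ∀ q' ∈ (copyGame n).Fsupp f, level q' = p.1.length + 1 := by
    intro q' hq'
    obtain ⟨q, hq, hs⟩ := hf.2.1 hq'
    have := hp.level_last hq
    rw [level_step hs (this.trans_le hlen), this]
  refine ⟨h, ?_, ?_, ?_, ?_⟩
  · rw [length_extend]
    omega
  · intro i hi
    rw [length_extend] at hi
    rcases hi.lt_or_eq with hi | rfl
    · rw [posFun_extend _ _ _ (by omega)]
      exact hp.obs i (by omega)
    · rw [hlast]
      exact hf.1
  · intro i hi
    rw [length_extend] at hi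
    rcases hi.lt_or_eq with hi | rfl
    · rw [posFun_extend _ _ _ (by omega)]
      exact hp.level_eq i (by omega)
    · rw [hlast]
      exact hlev
  · intro q' x hx
    change f q' = some x at hx
    have hq' : q' ∈ (copyGame n).Fsupp f := by
      change f q' ≠ none
      rw [hx]
      simp
    refine le_of_eq_of_le ?_ (hp.bound_succ hf q' x hx)
    have hl := hlev q' hq'
    rcases q' with _ | ⟨i, b, j, v⟩
    · simp [level] at hl
    · congr 1
      refine potential_congr fun l hli => ?_
      simp only [level] at hl
      simp only [posBits]
      rw [posFun_extend _ _ _ (by omega)]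

theorem FirstRound.inTE_extend {p : (copyGame n).Pos} (hp : FirstRound p)
    (hlen : p.1.length = n + 1) {f : (copyGame n).FF}
    (h : (copyGame n).ValidPos' ((copyGame n).extend p (posBits p) f)) :
    (copyGame n).inTE ((copyGame n).extend p (posBits p) f) := by
  have hf := FirstRound.isSucc_of_valid h
  refine ⟨0, by rw [length_extend]; omega, ?_⟩
  rw [h.1.1]
  have hnone : ∀ q' ∈ (copyGame n).Fsupp f, q' = (none : State n) := by
    intro q' hq'
    obtain ⟨q, hq, hs⟩ := hf.2.1 hq'
    exact eq_none_of_step hs ((hp.level_last hq).trans hlen)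
  obtain ⟨q₀, hq₀⟩ := obs_nonempty hf.1
  obtain rfl := hnone q₀ hq₀
  have hsupp : (copyGame n).Fsupp f = {none} :=
    Set.eq_singleton_iff_unique_mem.2 ⟨hq₀, hnone⟩
  refine ⟨fsupp_fI.trans hsupp.symm, fun q hq => ?_⟩
  rw [fsupp_fI] at hq
  obtain rfl := Set.mem_singleton_iff.1 hq
  obtain ⟨x, hx⟩ := Option.ne_none_iff_exists'.1 hq₀
  refine ⟨((0 : ℤ) : WithTop ℤ), x, ?_, hx, ?_⟩
  · simp only [MPG.fI]
    exact if_pos rfl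
  · have := hp.bound_succ hf none x hx
    simpa [potential] using this

theorem forciblyFAC : (copyGame n).ForciblyFAC := by
  refine Or.inl ⟨posBits, fun ps h0 hnext => ?_⟩
  have hstep : ∀ k, FirstRound (ps k) → ∃ f,
      ps (k + 1) = (copyGame n).extend (ps k) (posBits (ps k)) f ∧
        (copyGame n).ValidPos' ((copyGame n).extend (ps k) (posBits (ps k)) f) := by
    intro k hk
    rcases (hnext k).2 hk.not_terminal with ⟨f, hf, hv⟩ | ⟨hno, -⟩
    · exact ⟨f, hf, hf ▸ hv⟩
    · exact absurd (hk.exists_extend _) hno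
  have hround : ∀ k ≤ n + 1, FirstRound (ps k) ∧ (ps k).1.length = k := by
    intro k
    induction k with
    | zero =>
      intro _
      rw [h0]
      exact ⟨firstRound_init, rfl⟩
    | succ k ih =>
      intro hk
      obtain ⟨hr, hl⟩ := ih (by omega)
      obtain ⟨f, hf, hv⟩ := hstep k hr
      rw [hf, length_extend, hl]
      exact ⟨hr.extend (by omega) hv, rfl⟩
  obtain ⟨hr, hl⟩ := hround (n + 1) le_rfl
  obtain ⟨f, hf, hv⟩ := hstep (n + 1) hr
  exact ⟨n + 2, hf ▸ hr.inTE_extend hl hv⟩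

end CopyGame

/-- there are polynomial-size forcibly FAC games requiring
exponential memory for Eve's winning strategies. -/
theorem forciblyFAC_exponential_memory_lower_bound :
    ∃ p : Polynomial ℕ, ∀ n : ℕ, ∃ G : MPG,
      G.LimitedObs ∧ G.ForciblyFAC ∧
      (@Fintype.card G.Q G.fintypeQ) ≤ p.eval n ∧
      (∃ st : G.EveStrategy, G.EveWinningStrategy st) ∧
      ∀ st : G.EveStrategy, G.EveWinningStrategy st →
        ∀ m : ℕ, G.HasMemory st m → 2 ^ n ≤ m := by
  refine ⟨1 + 4 * (Polynomial.X + 1) ^ 2, fun n => ⟨copyGame n, CopyGame.limitedObs,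
    CopyGame.forciblyFAC, ?_, ⟨_, CopyGame.copyStrategy_winning⟩,
    fun _ hst _ hm => CopyGame.memory_lower_bound hst hm⟩⟩
  change Fintype.card (CopyGame.State n) ≤ _
  simp only [Fintype.card_option, Fintype.card_prod, Fintype.card_fin, Fintype.card_bool,
    Polynomial.eval_add, Polynomial.eval_mul, Polynomial.eval_pow, Polynomial.eval_X,
    Polynomial.eval_one, Polynomial.eval_ofNat]
  nlinarith
end
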